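/- Let a n denote the number of no-growth permutations of Fin n. Then for every n ≥ 1, as integers, a n = ∑_{k=0}^{n−1} (−1)^k · (n−k)! · ∑_{i=0}^{k} (n−k).choose i · (n−i−1).choose (k−i). (This is the Abramson–Moser formula for the n-kings problem.) -/

import Mathlib

/-- Two cells of the `n × n` board are cardinal (north/south/east/west) neighbors. -/
def Adj {n : ℕ} (c d : Fin n × Fin n) : Prop :=
  (c.1 = d.1 ∧ ((c.2 : ℕ) + 1 = (d.2 : ℕ) ∨ (d.2 : ℕ) + 1 = (c.2 : ℕ))) ∨
  (c.2 = d.2 ∧ ((c.1 : ℕ) + 1 = (d.1 : ℕ) ∨ (d.1 : ℕ) + 1 = (c.1 : ℕ)))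

/-- A cell `c` is mutable for a set `T` of cells: `c ∉ T` and at least two of its
cardinal neighbors belong to `T`. -/
def IsMutable {n : ℕ} (T : Set (Fin n × Fin n)) (c : Fin n × Fin n) : Prop :=
  c ∉ T ∧ ∃ d ∈ T, ∃ e ∈ T, d ≠ e ∧ Adj c d ∧ Adj c e

/-- One percolation step: adjoin a single mutable cell. -/
def PercStep {n : ℕ} (T T' : Set (Fin n × Fin n)) : Prop :=
  ∃ c, IsMutable T c ∧ T' = T ∪ {c}

/-- The graph of a permutation `π`, i.e. the set of cells `(i, π i)`. -/
def graphOf {n : ℕ} (π : Equiv.Perm (Fin n)) : Set (Fin n × Fin n) :=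
  {p | p.2 = π p.1}

/-- A set of cells is percolation-closed if it contains every cell having at least two
cardinal neighbors in the set. -/
def PercClosed {n : ℕ} (S : Set (Fin n × Fin n)) : Prop :=
  ∀ c, (∃ d ∈ S, ∃ e ∈ S, d ≠ e ∧ Adj c d ∧ Adj c e) → c ∈ S

/-- The percolation closure of `π`: the smallest percolation-closed set containing the
graph of `π`. -/
def percClosure {n : ℕ} (π : Equiv.Perm (Fin n)) : Set (Fin n × Fin n) :=
  ⋂₀ {S | graphOf π ⊆ S ∧ PercClosed S}

/-- `π` is full if its percolation closure is the whole board. -/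
def Full {n : ℕ} (π : Equiv.Perm (Fin n)) : Prop :=
  percClosure π = Set.univ

/-- A permutation of `Fin m` is indecomposable if it maps no proper initial segment
`{0, …, k−1}` (with `1 ≤ k < m`) onto itself. -/
def Indecomposable {m : ℕ} (σ : Equiv.Perm (Fin m)) : Prop :=
  ¬ ∃ k, 1 ≤ k ∧ k < m ∧
    (fun i => σ i) '' {i : Fin m | (i : ℕ) < k} = {i : Fin m | (i : ℕ) < k}

/-- `π` is no-growth if no cell is mutable for its graph. -/
def NoGrowth {n : ℕ} (π : Equiv.Perm (Fin n)) : Prop :=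
  ∀ c, ¬ IsMutable (graphOf π) c

/-- The number of no-growth permutations of `Fin m` (solutions to the `m`-kings problem). -/
noncomputable def numNoGrowth (m : ℕ) : ℕ :=
  Nat.card {π : Equiv.Perm (Fin m) // NoGrowth π}

namespace Kings
open Finset

/-! Delannoy-type numbers -/
noncomputable def Pser (j : ℕ) : PowerSeries ℤ := PowerSeries.mk fun k => (Nat.multichoose j k : ℤ)
noncomputable def Qser (j : ℕ) : PowerSeries ℤ := PowerSeries.mk fun k => (Nat.choose j k : ℤ)

lemma Pser_succ (j : ℕ) : (1 - PowerSeries.X) * Pser (j+1) = Pser j := by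
  ext k
  rw [sub_mul, one_mul, map_sub]
  cases k with
  | zero => simp [Pser]
  | succ k =>
    rw [PowerSeries.coeff_succ_X_mul]
    simp [Pser, Nat.multichoose_succ_succ]

lemma Qser_succ (j : ℕ) : Qser (j+1) = (1 + PowerSeries.X) * Qser j := by
  ext k
  rw [add_mul, one_mul, map_add]
  cases k with
  | zero => simp [Qser]
  | succ k =>
    rw [PowerSeries.coeff_succ_X_mul]
    simp [Qser, Nat.choose_succ_succ]
    ring

noncomputable def c (j k : ℕ) : ℤ := PowerSeries.coeff k (Qser j * Pser j)

lemma c_rec (j k : ℕ) : c (j+1) (k+1) = c j (k+1) + c (j+1) k + c j k := by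
  have h : (1 - PowerSeries.X) * (Qser (j+1) * Pser (j+1))
      = (1 + PowerSeries.X) * (Qser j * Pser j) := by
    rw [← Pser_succ j, Qser_succ]; ring
  have h2 := congrArg (PowerSeries.coeff (k+1)) h
  rw [sub_mul, one_mul, add_mul, one_mul, map_sub, map_add, PowerSeries.coeff_succ_X_mul,
    PowerSeries.coeff_succ_X_mul] at h2
  unfold c
  linarith

lemma c_eq (j k : ℕ) : c j k =
    ∑ i ∈ Finset.range (k + 1), (j.choose i : ℤ) * ((j + k - i - 1).choose (k - i) : ℤ) := by
  unfold c
  rw [PowerSeries.coeff_mul, Finset.Nat.sum_antidiagonal_eq_sum_range_succ_mk]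
  apply Finset.sum_congr rfl
  intro i hi
  rw [Finset.mem_range] at hi
  simp only [Pser, Qser, PowerSeries.coeff_mk, Nat.multichoose_eq]
  rw [show j + (k - i) - 1 = j + k - i - 1 by omega]

lemma c_zero_right (j : ℕ) : c j 0 = 1 := by simp [c_eq]
lemma c_zero_left (k : ℕ) : c 0 (k+1) = 0 := by
  rw [c_eq, Finset.sum_eq_zero]
  intro i hi
  cases i with
  | zero => simp
  | succ i => simp

/-! Marked permutations -/
def Cons {n : ℕ} (x y : Fin n) : Prop := (x : ℕ) + 1 = y ∨ (y : ℕ) + 1 = x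
instance {n : ℕ} (x y : Fin n) : Decidable (Cons x y) := by unfold Cons; infer_instance

def Good {m : ℕ} (S : Fin m → Bool) (σ : Equiv.Perm (Fin (m+1))) : Prop :=
  ∀ i, S i = true → Cons (σ i.castSucc) (σ i.succ)
instance {m : ℕ} (S : Fin m → Bool) (σ : Equiv.Perm (Fin (m+1))) : Decidable (Good S σ) := by
  unfold Good; infer_instance

def N {m : ℕ} (S : Fin m → Bool) : ℤ := ∑ σ : Equiv.Perm (Fin (m+1)), if Good S σ then 1 else 0
def sz {m : ℕ} (S : Fin m → Bool) : ℕ := ∑ i, (S i).toNat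
def hd : {m : ℕ} → (Fin m → Bool) → Bool
  | 0, _ => false
  | _+1, S => S 0

lemma ins_inj {m : ℕ} (v : Fin (m+2)) (σ : Equiv.Perm (Fin (m+1))) :
    Function.Injective (Fin.cons v (fun i => v.succAbove (σ i)) : Fin (m+2) → Fin (m+2)) := by
  rw [Fin.cons_injective_iff]
  constructor
  · rintro ⟨i, hi⟩
    exact Fin.succAbove_ne _ _ hi
  · exact Fin.succAbove_right_injective.comp σ.injective

noncomputable def ins {m : ℕ} (p : Fin (m+2) × Equiv.Perm (Fin (m+1))) : Equiv.Perm (Fin (m+2)) :=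
  Equiv.ofBijective _ (Finite.injective_iff_bijective.mp (ins_inj p.1 p.2))

lemma ins_zero {m : ℕ} (v : Fin (m+2)) (σ : Equiv.Perm (Fin (m+1))) : ins (v, σ) 0 = v := rfl
lemma ins_succ {m : ℕ} (v : Fin (m+2)) (σ : Equiv.Perm (Fin (m+1))) (i : Fin (m+1)) :
    ins (v, σ) i.succ = v.succAbove (σ i) := rfl

lemma ins_bij {m : ℕ} : Function.Bijective (ins (m := m)) := by
  rw [Fintype.bijective_iff_injective_and_card]
  constructor
  · rintro ⟨v, σ⟩ ⟨w, τ⟩ h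
    have h0 : v = w := by
      have := congrArg (fun f => f 0) h
      simpa [ins_zero] using this
    subst h0
    congr 1
    ext i
    have := congrArg (fun f => f i.succ) h
    simp only [ins_succ] at this
    rw [Fin.succAbove_right_injective this]
  · simp [Fintype.card_perm, Nat.factorial_succ]

lemma cons_succAbove {m : ℕ} (v : Fin (m+2)) (x y : Fin (m+1)) :
    Cons (v.succAbove x) (v.succAbove y) ↔ Cons x y ∧ (v : ℕ) ≠ max (x : ℕ) y := by
  unfold Cons
  simp only [Fin.succAbove, Fin.lt_def, Fin.val_castSucc]
  split_ifs <;> simp only [Fin.val_castSucc, Fin.val_succ] <;> omega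

lemma cons_head {m : ℕ} (v : Fin (m+2)) (x : Fin (m+1)) :
    Cons v (v.succAbove x) ↔ ((v : ℕ) = x ∨ (v : ℕ) = x + 1) := by
  unfold Cons
  simp only [Fin.succAbove, Fin.lt_def, Fin.val_castSucc]
  split_ifs <;> simp only [Fin.val_castSucc, Fin.val_succ] <;> omega

def Av {m : ℕ} (S : Fin m → Bool) (σ : Equiv.Perm (Fin (m+1))) (v : Fin (m+2)) : Prop :=
  ∀ i, S i = true → (v : ℕ) ≠ max (σ i.castSucc : ℕ) (σ i.succ)
instance {m : ℕ} (S : Fin m → Bool) (σ : Equiv.Perm (Fin (m+1))) (v : Fin (m+2)) :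
    Decidable (Av S σ v) := by
  unfold Av; infer_instance

lemma good_ins {m : ℕ} (b : Bool) (S : Fin m → Bool) (v : Fin (m+2)) (σ : Equiv.Perm (Fin (m+1))) :
    Good (Fin.cons b S : Fin (m+1) → Bool) (ins (v, σ)) ↔
      Good S σ ∧ Av S σ v ∧ (b = true → ((v : ℕ) = σ 0 ∨ (v : ℕ) = σ 0 + 1)) := by
  unfold Good Av
  rw [Fin.forall_fin_succ]
  simp only [Fin.cons_zero, Fin.cons_succ, Fin.castSucc_zero, ← Fin.succ_castSucc, ins_zero, ins_succ,
    cons_succAbove, cons_head]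
  grind

lemma N_cons {m : ℕ} (b : Bool) (S : Fin m → Bool) (t : ℤ)
    (h : ∀ σ, Good S σ → (∑ v : Fin (m+2),
      if Av S σ v ∧ (b = true → ((v : ℕ) = σ 0 ∨ (v : ℕ) = σ 0 + 1)) then (1:ℤ) else 0) = t) :
    N (Fin.cons b S : Fin (m+1) → Bool) = t * N S := by
  unfold N
  rw [← (Equiv.ofBijective _ (ins_bij (m := m))).sum_comp, Fintype.sum_prod_type_right, Finset.mul_sum]
  apply Finset.sum_congr rfl
  intro σ _
  simp only [Equiv.ofBijective_apply, good_ins]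
  by_cases hg : Good S σ
  · simp only [hg, true_and, if_true, mul_one]
    exact h σ hg
  · simp [hg]

lemma val_inj {m : ℕ} (σ : Equiv.Perm (Fin (m+1))) {a b : Fin (m+1)} (h : (σ a : ℕ) = σ b) :
    (a : ℕ) = b := by
  rw [σ.injective (Fin.ext h)]

lemma max_inj {m : ℕ} (S : Fin m → Bool) (σ : Equiv.Perm (Fin (m+1))) (hg : Good S σ)
    (i j : Fin m) (hi : S i = true) (hj : S j = true)
    (h : max (σ i.castSucc : ℕ) (σ i.succ) = max (σ j.castSucc : ℕ) (σ j.succ)) : i = j := by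
  have h1 := hg i hi
  have h2 := hg j hj
  have e1 := @val_inj _ σ i.castSucc j.castSucc
  have e2 := @val_inj _ σ i.castSucc j.succ
  have e3 := @val_inj _ σ i.succ j.castSucc
  have e4 := @val_inj _ σ i.succ j.succ
  unfold Cons at h1 h2
  simp only [Fin.val_castSucc, Fin.val_succ] at e1 e2 e3 e4
  ext
  omega

lemma sz_eq {m : ℕ} (S : Fin m → Bool) : sz S = #{i | S i = true} := by
  unfold sz
  rw [Finset.card_filter]
  apply Finset.sum_congr rfl
  intro i _
  cases S i <;> simp

lemma N_false {m : ℕ} (S : Fin m → Bool) :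
    N (Fin.cons false S : Fin (m+1) → Bool) = ((m : ℤ) + 2 - sz S) * N S := by
  apply N_cons
  intro σ hg
  simp only [Bool.false_eq_true, false_imp_iff, and_true]
  rw [← Finset.natCast_card_filter]
  let f : Fin m → Fin (m+2) := fun i => ⟨max (σ i.castSucc : ℕ) (σ i.succ), by omega⟩
  have e : (univ.filter fun v => Av S σ v) = ((univ.filter fun i => S i = true).image f)ᶜ := by
    ext v
    simp only [mem_filter, mem_univ, true_and, mem_compl, mem_image, not_exists, not_and, Av, f,
      Fin.ext_iff]
    grind
  have hc : #((univ.filter fun i => S i = true).image f) = sz S := by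
    rw [sz_eq, Finset.card_image_of_injOn]
    intro i hi j hj hij
    simp only [coe_filter, mem_univ, true_and, Set.mem_ofPred_eq] at hi hj
    exact max_inj S σ hg i j hi hj (by simpa [f, Fin.ext_iff] using hij)
  have hle : sz S ≤ m := by
    rw [sz_eq]; exact (Finset.card_le_univ _).trans (by simp)
  rw [e, Finset.card_compl, hc, Fintype.card_fin, Nat.cast_sub (by omega)]
  push_cast; ring

lemma N_true {m : ℕ} (S : Fin m → Bool) :
    N (Fin.cons true S : Fin (m+1) → Bool) = (if hd S = true then 1 else 2) * N S := by
  apply N_cons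
  intro σ hg
  simp only [forall_const]
  rw [← Finset.natCast_card_filter]
  let lo : Fin (m+2) := (σ 0).castSucc
  let hi : Fin (m+2) := (σ 0).succ
  have hlh : lo ≠ hi := by simp [lo, hi, Fin.ext_iff]
  have key : ∀ i : Fin m, (i : ℕ) ≠ 0 → S i = true →
      max (σ i.castSucc : ℕ) (σ i.succ) ≠ σ 0 ∧ max (σ i.castSucc : ℕ) (σ i.succ) ≠ σ 0 + 1 := by
    intro i hi0 hi
    have h1 := hg i hi
    have e1 := @val_inj _ σ i.castSucc 0
    have e2 := @val_inj _ σ i.succ 0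
    unfold Cons at h1
    simp only [Fin.val_castSucc, Fin.val_succ, Fin.val_zero] at e1 e2
    omega
  by_cases hS : hd S = true
  · rw [if_pos hS]
    cases m with
    | zero => simp [hd] at hS
    | succ m =>
      have hS0 : S 0 = true := hS
      have h1 := hg 0 hS0
      have : ∃ w, (univ.filter fun v : Fin (m+1+2) =>
          Av S σ v ∧ ((v : ℕ) = σ 0 ∨ (v : ℕ) = σ 0 + 1)) = {w} := by
        rw [Fin.castSucc_zero] at h1
        rcases h1 with h1 | h1
        · refine ⟨lo, ?_⟩
          ext v
          rw [mem_filter]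
          simp only [mem_univ, true_and, mem_singleton, Av, Fin.ext_iff, lo,
            Fin.val_castSucc]
          constructor
          · rintro ⟨h2, h3⟩
            have := h2 0 hS0
            rw [Fin.castSucc_zero] at this
            omega
          · intro h
            refine ⟨fun i hi => ?_, Or.inl h⟩
            by_cases h0 : (i : ℕ) = 0
            · obtain rfl : i = 0 := Fin.ext h0
              rw [Fin.castSucc_zero]; omega
            · have := key i h0 hi
              omega
        · refine ⟨hi, ?_⟩
          ext v
          rw [mem_filter]
          simp only [mem_univ, true_and, mem_singleton, Av, Fin.ext_iff, hi,
            Fin.val_succ]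
          constructor
          · rintro ⟨h2, h3⟩
            have := h2 0 hS0
            rw [Fin.castSucc_zero] at this
            omega
          · intro h
            refine ⟨fun i hi => ?_, Or.inr h⟩
            by_cases h0 : (i : ℕ) = 0
            · obtain rfl : i = 0 := Fin.ext h0
              rw [Fin.castSucc_zero]; omega
            · have := key i h0 hi
              omega
      obtain ⟨w, hw⟩ := this
      rw [hw]; simp
  · rw [if_neg hS]
    have : (univ.filter fun v : Fin (m+2) =>
          Av S σ v ∧ ((v : ℕ) = σ 0 ∨ (v : ℕ) = σ 0 + 1)) = {lo, hi} := by
      ext v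
      rw [mem_filter]
      simp only [mem_univ, true_and, mem_singleton, mem_insert, Av, Fin.ext_iff, hi, lo,
            Fin.val_succ, Fin.val_castSucc]
      constructor
      · exact fun h => h.2
      · intro h
        refine ⟨fun i hi => ?_, h⟩
        have h0 : (i : ℕ) ≠ 0 := by
          intro h0
          cases m with
          | zero => exact i.elim0
          | succ m =>
            obtain rfl : i = 0 := Fin.ext h0
            exact hS hi
        have := key i h0 hi
        omega
    rw [this, Finset.card_pair hlh]; simp

/-! Summation over markings -/
def T (m k : ℕ) (b : Bool) : ℤ := ∑ S : Fin m → Bool, if sz S = k ∧ hd S = b then N S else 0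

lemma sum_cons {m : ℕ} (f : (Fin (m+1) → Bool) → ℤ) :
    ∑ S, f S = ∑ S : Fin m → Bool, f (Fin.cons true S) + ∑ S : Fin m → Bool, f (Fin.cons false S) := by
  rw [← (Fin.consEquiv (fun _ : Fin (m+1) => Bool)).sum_comp, Fintype.sum_prod_type]
  simp [Fin.consEquiv]

lemma hd_cons {m : ℕ} (b : Bool) (S : Fin m → Bool) :
    hd (Fin.cons b S : Fin (m+1) → Bool) = b := rfl

lemma sz_cons {m : ℕ} (b : Bool) (S : Fin m → Bool) :
    sz (Fin.cons b S : Fin (m+1) → Bool) = b.toNat + sz S := by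
  simp [sz, Fin.sum_univ_succ]

lemma sz_le {m : ℕ} (S : Fin m → Bool) : sz S ≤ m := by
  rw [sz_eq]; exact (Finset.card_le_univ _).trans (by simp)

lemma T_big (m k : ℕ) (b : Bool) (h : m < k) : T m k b = 0 := by
  unfold T
  apply Finset.sum_eq_zero
  intro S _
  have := sz_le S
  rw [if_neg (by omega)]

lemma T_false (m k : ℕ) : T (m+1) k false = ((m:ℤ)+2-k) * (T m k false + T m k true) := by
  unfold T
  rw [sum_cons, ← Finset.sum_add_distrib, ← Finset.sum_add_distrib, Finset.mul_sum]
  apply Finset.sum_congr rfl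
  intro S _
  simp only [sz_cons, N_false, hd_cons]
  by_cases h : sz S = k
  · cases hb : hd S <;> simp [h]
  · simp [h]

lemma T_true (m k : ℕ) : T (m+1) (k+1) true = 2 * T m k false + T m k true := by
  unfold T
  rw [sum_cons, ← Finset.sum_add_distrib, Finset.mul_sum, ← Finset.sum_add_distrib]
  apply Finset.sum_congr rfl
  intro S _
  simp only [sz_cons, N_true, hd_cons]
  by_cases h : sz S = k
  · cases hb : hd S <;> simp [h, add_comm]
  · have : ¬ (1 + sz S = k + 1) := by omega
    simp [h, this]

lemma T_true0 (m : ℕ) : T (m+1) 0 true = 0 := by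
  unfold T
  rw [sum_cons]
  simp [sz_cons, hd_cons]

lemma T_zero : T 0 0 false = 1 ∧ T 0 0 true = 0 := by
  constructor
  · simp [T, sz, hd, N, Good]
  · simp [T, sz, hd]

lemma T_closed (m : ℕ) : ∀ j k, j + k = m →
    T m k false = (j+1).factorial * c j k ∧
    T m k false + T m k true = (j+1).factorial * c (j+1) k := by
  induction m with
  | zero =>
    intro j k h
    obtain ⟨rfl, rfl⟩ : j = 0 ∧ k = 0 := by omega
    simp [T_zero, c_zero_right]
  | succ m ih =>
    intro j k h
    have h1 : T (m+1) k false = (j+1).factorial * c j k := by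
      rw [T_false]
      cases j with
      | zero =>
        obtain rfl : k = m+1 := by omega
        rw [T_big _ _ _ (by omega), T_big _ _ _ (by omega), c_zero_left]
        simp
      | succ j =>
        rw [(ih j k (by omega)).2, Nat.factorial_succ (j+1)]
        have : (m : ℤ) = j + k := by omega
        rw [this]; push_cast; ring
    refine ⟨h1, ?_⟩
    rw [h1]
    cases k with
    | zero => rw [T_true0, c_zero_right, c_zero_right]; ring
    | succ k =>
      have h2 := ih j k (by omega)
      rw [T_true, c_rec]
      linarith [h2.1, h2.2]

/-! No-growth -/
lemma noGrowth_iff {m : ℕ} (π : Equiv.Perm (Fin (m+1))) :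
    NoGrowth π ↔ ∀ i : Fin m, ¬ Cons (π i.castSucc) (π i.succ) := by
  constructor
  · intro h i hc
    refine h (i.castSucc, π i.succ) ⟨?_, (i.castSucc, π i.castSucc), rfl, (i.succ, π i.succ), rfl,
      ?_, ?_, ?_⟩
    · intro h
      have h' : π i.succ = π i.castSucc := h
      have := congrArg Fin.val (π.injective h')
      simp at this
    · intro h
      have := congrArg (fun p => (p.1 : ℕ)) h
      simp at this
    · left
      unfold Cons at hc
      exact ⟨rfl, by simp only; omega⟩
    · right
      exact ⟨rfl, by simp⟩
  · rintro h ⟨i, j⟩ ⟨hc, ⟨d1, d2⟩, hd, ⟨e1, e2⟩, he, hne, had, hae⟩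
    have key : ∀ a b : Fin (m+1), (a : ℕ) + 1 = b → Cons (π a) (π b) → False := by
      intro a b hab hC
      refine h ⟨a, by omega⟩ ?_
      have : (⟨a, by omega⟩ : Fin m).succ = b := by ext; simpa using hab
      rw [this]
      exact hC
    have key2 : ∀ a b : Fin (m+1), ((a : ℕ) + 1 = b ∨ (b : ℕ) + 1 = a) → Cons (π a) (π b) → False := by
      intro a b hab hC
      rcases hab with hab | hab
      · exact key a b hab hC
      · exact key b a hab (by unfold Cons at *; omega)
    simp only [graphOf, Set.mem_ofPred_eq] at hd he hc
    subst hd he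
    simp only [Adj] at had hae
    rcases had with ⟨rfl, h1⟩ | ⟨h0, h1⟩ <;> rcases hae with ⟨h0', h2⟩ | ⟨h0', h2⟩
    · subst h0'; exact hne rfl
    · subst h0'
      exact key2 _ _ h2 (by unfold Cons; omega)
    · subst h0 h0'
      exact key2 _ _ h1 (by unfold Cons; omega)
    · have : d1 = e1 := π.injective (h0.symm.trans h0')
      subst this; exact hne rfl

lemma prod_expand {m : ℕ} (π : Equiv.Perm (Fin (m+1))) :
    (if ∀ i : Fin m, ¬ Cons (π i.castSucc) (π i.succ) then (1:ℤ) else 0) =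
      ∑ S : Fin m → Bool, (-1)^(sz S) * if Good S π then 1 else 0 := by
  have h1 : (if ∀ i : Fin m, ¬ Cons (π i.castSucc) (π i.succ) then (1:ℤ) else 0) =
      ∏ i : Fin m, ∑ b : Bool, if b = true then
        (-1 : ℤ) * (if Cons (π i.castSucc) (π i.succ) then 1 else 0) else 1 := by
    split_ifs with h
    · symm; apply Finset.prod_eq_one
      intro i _
      simp [h i]
    · push Not at h
      obtain ⟨i, hi⟩ := h
      symm; apply Finset.prod_eq_zero (mem_univ i)
      simp [hi]
  rw [h1, Finset.prod_univ_sum, Fintype.piFinset_univ]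
  apply Finset.sum_congr rfl
  intro S _
  unfold sz
  rw [← Finset.prod_pow_eq_pow_sum]
  by_cases hg : Good S π
  · rw [if_pos hg, mul_one]
    apply Finset.prod_congr rfl
    intro i _
    cases hi : S i
    · simp
    · simp [hg i hi]
  · rw [if_neg hg, mul_zero]
    unfold Good at hg
    push Not at hg
    obtain ⟨i, hi, hn⟩ := hg
    apply Finset.prod_eq_zero (mem_univ i)
    simp [hi, hn]

lemma count {m : ℕ} : (numNoGrowth (m+1) : ℤ) = ∑ S : Fin m → Bool, (-1)^(sz S) * N S := by
  have : numNoGrowth (m+1) = #{π : Equiv.Perm (Fin (m+1)) |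
      ∀ i : Fin m, ¬ Cons (π i.castSucc) (π i.succ)} := by
    unfold numNoGrowth
    simp only [noGrowth_iff]
    rw [Nat.card_eq_fintype_card, Fintype.card_subtype]
  rw [this, Finset.natCast_card_filter]
  simp only [prod_expand]
  rw [Finset.sum_comm]
  simp only [N, Finset.mul_sum]

lemma count2 {m : ℕ} : (numNoGrowth (m+1) : ℤ) =
    ∑ k ∈ range (m+1), (-1)^k * (T m k false + T m k true) := by
  rw [count]
  simp only [T]
  simp only [← Finset.sum_add_distrib, Finset.mul_sum]
  rw [Finset.sum_comm]
  apply Finset.sum_congr rfl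
  intro S _
  have := sz_le S
  rw [Finset.sum_eq_single (sz S)]
  · cases hd S <;> simp
  · intro k _ hk
    simp [hk.symm]
  · intro h; simp at h; omega

end Kings

theorem stmt_19 (n : ℕ) (hn : 1 ≤ n) :
    (numNoGrowth n : ℤ) =
      ∑ k ∈ Finset.range n, (-1 : ℤ) ^ k * (Nat.factorial (n - k) : ℤ) *
        ∑ i ∈ Finset.range (k + 1),
          ((n - k).choose i : ℤ) * ((n - i - 1).choose (k - i) : ℤ) := by
  obtain ⟨m, rfl⟩ : ∃ m, n = m + 1 := ⟨n - 1, by omega⟩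
  rw [Kings.count2]
  apply Finset.sum_congr rfl
  intro k hk
  rw [Finset.mem_range] at hk
  obtain ⟨j, rfl⟩ : ∃ j, m = j + k := ⟨m - k, by omega⟩
  rw [(Kings.T_closed (j+k) j k rfl).2, Kings.c_eq, mul_assoc,
    show j + k + 1 - k = j + 1 by omega, show j + 1 + k = j + k + 1 by omega]
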